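/- Let (X, τ) be a topological space, τ₁ a topology on X weaker than τ, I ⊆ ℝ an interval, and F : I → 2^X a multifunction with τ₁-closed values such that for each x ∈ X the set I \ F⁻(x) = {λ ∈ I : x ∉ F(λ)} is a non-empty subinterval of I that is open in I. Suppose there is λ₀ ∈ I such that F(λ₀) is non-empty and τ-compact. Then there exists λ* ∈ I such that F is not τ₁-lower semicontinuous at λ*, and moreover NLS_{τ₁}(F(λ*)) ∩ F(λ₀) ≠ ∅. -/

import Mathlib

theorem ricceri_aux {X L : Type*} [LinearOrder L] [TopologicalSpace L] [OrderTopology L]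
    [DenselyOrdered L]
    (H : ∀ S : Set L, S.Nonempty → BddBelow S → ∃ a, IsGLB S a)
    (τ τ₁ : TopologicalSpace X)
    (hweak : ∀ A : Set X, @IsOpen X τ₁ A → @IsOpen X τ A)
    (F : L → Set X)
    (hvals : ∀ l : L, @IsClosed X τ₁ (F l))
    (hne : ∀ x : X, {l : L | x ∉ F l}.Nonempty)
    (hconn : ∀ x : X, {l : L | x ∉ F l}.OrdConnected)
    (hopen : ∀ x : X, IsOpen {l : L | x ∉ F l})
    (l₀ : L) (hcomp : @IsCompact X τ (F l₀))
    (x₀ : X) (hx₀ : ∀ l ≤ l₀, x₀ ∈ F l) :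
    ∃ lstar : L, ∃ s ∈ F lstar, s ∈ F l₀ ∧ ∃ Ω : Set X, @IsOpen X τ₁ Ω ∧ s ∈ Ω ∧
      lstar ∈ closure {l : L | ¬ (F l ∩ Ω).Nonempty} := by
  have hcl : ∀ l, @IsClosed X τ (F l) := fun l =>
    @IsClosed.mk X τ _ (hweak _ (@IsClosed.isOpen_compl X τ₁ _ (hvals l)))
  let D : L → Set X := fun m => ⋂ l ∈ Set.Iic m, F l
  have hD : ∀ m x, x ∈ D m ↔ ∀ l ≤ m, x ∈ F l := by intro m x; simp [D]
  let T : Set L := {m | l₀ ≤ m ∧ (D m).Nonempty}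
  have hT0 : l₀ ∈ T := ⟨le_rfl, x₀, (hD _ _).2 hx₀⟩
  have hDc : ∀ m, @IsClosed X τ (D m) := fun m =>
    @isClosed_iInter X _ τ _ fun l => @isClosed_iInter X _ τ _ fun _ => hcl l
  have hz : (⋂ m : T, D m).Nonempty := by
    have : Nonempty T := ⟨⟨l₀, hT0⟩⟩
    refine @IsCompact.nonempty_iInter_of_directed_nonempty_isCompact_isClosed X τ T _
      (fun m => D m) ?_ (fun m => m.2.2) ?_ (fun m => hDc m)
    · have : Antitone (fun m : T => D m) := by
        intro m n hmn x hx
        rw [hD] at hx ⊢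
        exact fun l hl => hx l (hl.trans hmn)
      exact this.directed_ge
    · intro m
      refine @IsCompact.of_isClosed_subset X τ _ _ hcomp (hDc m) ?_
      intro x hx
      exact (hD _ _).1 hx _ m.2.1
  obtain ⟨z, hz⟩ := hz
  have hzD : ∀ m ∈ T, ∀ l ≤ m, z ∈ F l := fun m hm =>
    (hD _ _).1 (Set.mem_iInter.1 hz ⟨m, hm⟩)
  have hlb : ∀ m ∈ T, ∀ l, z ∉ F l → m < l := fun m hm l hl => by
    by_contra h
    exact hl (hzD m hm l (not_lt.1 h))
  obtain ⟨a, ha⟩ := H _ (hne z) ⟨l₀, fun l hl => (hlb l₀ hT0 l hl).le⟩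
  have hTa : ∀ m ∈ T, m ≤ a := fun m hm => ha.2 fun l hl => (hlb m hm l hl).le
  have hza : z ∈ F a := by
    by_contra h
    have h0 : l₀ < a := hlb l₀ hT0 a h
    obtain ⟨b, hb, hbs⟩ := exists_Ioc_subset_of_mem_nhds ((hopen z).mem_nhds h) ⟨l₀, h0⟩
    obtain ⟨c, hbc, hca⟩ := exists_between hb
    exact absurd (ha.1 (hbs ⟨hbc, hca.le⟩)) (not_le.2 hca)
  obtain ⟨l₁, hl₁⟩ := hne z
  have hal : a < l₁ := lt_of_le_of_ne (ha.1 hl₁) (by rintro rfl; exact hl₁ hza)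
  refine ⟨a, z, hza, hzD l₀ hT0 l₀ le_rfl, (F l₁)ᶜ, (hvals l₁).isOpen_compl, hl₁, ?_⟩
  have h1 : a ∈ closure (Set.Ioo a l₁) := by
    rw [closure_Ioo hal.ne]
    exact ⟨le_rfl, hal.le⟩
  refine closure_mono ?_ h1
  rintro l ⟨hl, hl'⟩ ⟨y, hy, hy'⟩
  refine absurd (hTa l ⟨(hTa l₀ hT0).trans hl.le, y, (hD _ _).2 fun k hk => ?_⟩) (not_le.2 hl)
  by_contra hky
  exact (hconn y).out hky hy' ⟨hk, hl'.le⟩ hy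


/-- **Remark 1 (variant of Theorem 2).** Let `(X, τ)` be a topological space, `τ₁` a topology
on `X` weaker than `τ` (every `τ₁`-open set is `τ`-open), `I` a real interval, and
`F : I → 2^X` a multifunction with `τ₁`-closed values such that for each `x ∈ X` the set
`I \ F⁻(x) = {λ ∈ I : x ∉ F(λ)}` is a non-empty subinterval of `I` open in `I`. Suppose
there is `λ₀ ∈ I` with `F(λ₀)` non-empty and `τ`-compact. Then `F` is not `τ₁`-lower
semicontinuous at some `λ* ∈ I` with `NLS_{τ₁}(F(λ*)) ∩ F(λ₀) ≠ ∅`. -/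
theorem ricceri_thm2_compact {X : Type*} (τ τ₁ : TopologicalSpace X)
    (hweak : ∀ A : Set X, @IsOpen X τ₁ A → @IsOpen X τ A)
    (I : Set ℝ) (hI : I.OrdConnected)
    (F : I → Set X)
    (hvals : ∀ l : I, @IsClosed X τ₁ (F l))
    (hne : ∀ x : X, {l : I | x ∉ F l}.Nonempty)
    (hconn : ∀ x : X, {l : I | x ∉ F l}.OrdConnected)
    (hopen : ∀ x : X, IsOpen {l : I | x ∉ F l})
    (l₀ : I) (hFl₀ : (F l₀).Nonempty) (hcomp : @IsCompact X τ (F l₀)) :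
    ∃ lstar : I,
      (¬ ∀ Ω : Set X, @IsOpen X τ₁ Ω → (F lstar ∩ Ω).Nonempty →
        lstar ∈ interior {l : I | (F l ∩ Ω).Nonempty}) ∧
      ({s ∈ F lstar | ∃ Ω ∈ @nhds X τ₁ s,
          (lstar : I) ∈ closure {l : I | ¬ (F l ∩ Ω).Nonempty}} ∩ F l₀).Nonempty := by
  have key : ∃ lstar : I, ∃ s ∈ F lstar, s ∈ F l₀ ∧ ∃ Ω : Set X, @IsOpen X τ₁ Ω ∧ s ∈ Ω ∧
      lstar ∈ closure {l : I | ¬ (F l ∩ Ω).Nonempty} := by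
    obtain ⟨x, hx⟩ := hFl₀
    obtain ⟨l₁, hl₁⟩ := hne x
    have := hI
    rcases le_total l₀ l₁ with h | h
    · refine ricceri_aux ?_ τ τ₁ hweak F hvals hne hconn hopen l₀ hcomp x ?_
      · rintro S ⟨s, hs⟩ ⟨b, hb⟩
        have hbd : BddBelow (Subtype.val '' S) := ⟨b, by rintro _ ⟨t, ht, rfl⟩; exact hb ht⟩
        have hg := isGLB_csInf (Set.Nonempty.image Subtype.val ⟨s, hs⟩) hbd
        have hm : sInf (Subtype.val '' S) ∈ I := hI.out b.2 s.2
          ⟨hg.2 (by rintro _ ⟨t, ht, rfl⟩; exact hb ht), hg.1 ⟨s, hs, rfl⟩⟩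
        refine ⟨⟨_, hm⟩, fun t ht => hg.1 ⟨t, ht, rfl⟩, fun c hc => ?_⟩
        exact hg.2 (by rintro _ ⟨t, ht, rfl⟩; exact hc ht)
      · intro l hl
        by_contra hxl
        exact (hconn x).out hxl hl₁ ⟨hl, h⟩ hx
    · refine ricceri_aux (L := Iᵒᵈ) ?_ τ τ₁ hweak F hvals hne (fun x => (hconn x).dual) hopen
        l₀ hcomp x ?_
      · rintro S ⟨s, hs⟩ ⟨b, hb⟩
        change Set I at S
        change I at s b
        have hb : ∀ t ∈ S, t ≤ b := fun t ht => hb ht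
        have hbd : BddAbove (Subtype.val '' S) := ⟨b, by rintro _ ⟨t, ht, rfl⟩; exact hb t ht⟩
        have hg := isLUB_csSup (Set.Nonempty.image Subtype.val ⟨s, hs⟩) hbd
        have hm : sSup (Subtype.val '' S) ∈ I := hI.out s.2 b.2
          ⟨hg.1 ⟨s, hs, rfl⟩, hg.2 (by rintro _ ⟨t, ht, rfl⟩; exact hb t ht)⟩
        have : IsLUB S ⟨_, hm⟩ := by
          refine ⟨fun t ht => hg.1 ⟨t, ht, rfl⟩, fun c hc => ?_⟩
          exact hg.2 (by rintro _ ⟨t, ht, rfl⟩; exact hc ht)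
        exact ⟨OrderDual.toDual ⟨_, hm⟩, this⟩
      · intro l hl
        change I at l
        have hl : l₀ ≤ l := hl
        by_contra hxl
        exact (hconn x).out hl₁ hxl ⟨h, hl⟩ hx
  obtain ⟨a, s, hs, hs0, Ω, hΩ, hsΩ, hcl⟩ := key
  refine ⟨a, fun h => ?_, s, ⟨hs, Ω, hΩ.mem_nhds hsΩ, hcl⟩, hs0⟩
  have h1 := h Ω hΩ ⟨s, hs, hsΩ⟩
  have h2 : {l : I | ¬ (F l ∩ Ω).Nonempty} = {l : I | (F l ∩ Ω).Nonempty}ᶜ := rfl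
  rw [h2, closure_compl] at hcl
  exact hcl h1
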